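/- Let q be a nonempty acyclic Boolean conjunctive query without self-join and τ a join tree for q such that the attack graph of τ consists exactly of ℓ ≥ 1 vertex-disjoint weak cycles of length 2, namely F_1 ↝ G_1 ↝ F_1, …, F_ℓ ↝ G_ℓ ↝ F_ℓ, where every atom of q is one of the F_i or G_i and these are all the attacks. Let db be an uncertain database purified relative to q, with active domain D. For i = 1,…,ℓ, let q_i = {F_i, G_i}; let x⃗_i be a sequence of the distinct variables of vars(q_i) that also occur in vars(q_j) for some j ≠ i; let db_i be the set of facts of db whose relation name is the relation name of F_i or of G_i; for a tuple a⃗ of constants from D of length |x⃗_i|, the partition of db_i with vector a⃗ is the set of facts A ∈ db_i such that A = θ(F_i[x⃗_i→a⃗]) or A = θ(G_i[x⃗_i→a⃗]) for some valuation θ; and let clean(db_i) be the union of all partitions P of db_i with P ∈ CERTAINTY(q_i). Then db ∈ CERTAINTY(q) if and only if clean(db_1) ∪ … ∪ clean(db_ℓ) ⊨ q. -/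

import Mathlib

attribute [local instance] Classical.propDecidable

noncomputable section

/-- A term is either a variable (`Sum.inl v`) or a constant (`Sum.inr c`),
variables and constants both being coded by natural numbers
(the two copies of `ℕ` are disjoint). -/
abbrev Trm := ℕ ⊕ ℕ

/-- A database schema assigns to every relation name (a natural number) an
arity `n` and a primary-key length `k` with `n ≥ k ≥ 1`; the primary key
consists of the first `k` positions. -/
structure Schema where
  arity : ℕ → ℕ
  keyLen : ℕ → ℕ
  keyLen_le_arity : ∀ R, keyLen R ≤ arity R
  one_le_keyLen : ∀ R, 1 ≤ keyLen R

/-- An atom: a relation name together with a list of arguments. -/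
structure Atom where
  rel : ℕ
  args : List Trm
deriving DecidableEq

/-- Variables occurring in a list of terms. -/
def varsL (l : List Trm) : Finset ℕ := (l.filterMap Sum.getLeft?).toFinset

/-- Constants occurring in a list of terms. -/
def constsL (l : List Trm) : Finset ℕ := (l.filterMap Sum.getRight?).toFinset

/-- All variables of an atom. -/
def varsA (A : Atom) : Finset ℕ := varsL A.args

/-- Key variables of an atom: variables in the primary-key positions. -/
def keyVars (S : Schema) (A : Atom) : Finset ℕ := varsL (A.args.take (S.keyLen A.rel))

/-- Constants of an atom. -/
def constsA (A : Atom) : Finset ℕ := constsL A.args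

/-- Well-formed atom: number of arguments equals the arity of its relation name. -/
def wfAtom (S : Schema) (A : Atom) : Prop := A.args.length = S.arity A.rel

/-- A fact is an atom without variables. -/
def isFact (A : Atom) : Prop := ∀ t ∈ A.args, ∃ c : ℕ, t = Sum.inr c

/-- Two (facts) are key-equal: same relation name, and same primary-key positions. -/
def keyEqual (S : Schema) (A B : Atom) : Prop :=
  A.rel = B.rel ∧ A.args.take (S.keyLen A.rel) = B.args.take (S.keyLen B.rel)

/-- The block of `A` in `db`: all facts of `db` key-equal to `A`. -/
def block (S : Schema) (A : Atom) (db : Finset Atom) : Finset Atom :=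
  db.filter (fun B => keyEqual S A B)

/-- An uncertain database: a finite set of well-formed facts. -/
def IsDb (S : Schema) (db : Finset Atom) : Prop := ∀ A ∈ db, isFact A ∧ wfAtom S A

/-- A set of facts is consistent if it contains no two distinct key-equal facts. -/
def Consistent (S : Schema) (db : Finset Atom) : Prop :=
  ∀ A ∈ db, ∀ B ∈ db, keyEqual S A B → A = B

/-- A repair of `db`: a maximal consistent subset of `db`. -/
def IsRepair (S : Schema) (db r : Finset Atom) : Prop :=
  r ⊆ db ∧ Consistent S r ∧
    ∀ r' : Finset Atom, r ⊆ r' → r' ⊆ db → Consistent S r' → r' = r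

/-- Applying a valuation (a total map from variables to constants) to a term. -/
def appT (θ : ℕ → ℕ) : Trm → Trm
  | Sum.inl v => Sum.inr (θ v)
  | Sum.inr c => Sum.inr c

/-- Applying a valuation to an atom. -/
def appA (θ : ℕ → ℕ) (A : Atom) : Atom := ⟨A.rel, A.args.map (appT θ)⟩

/-- Applying a valuation to a query. -/
def appQ (θ : ℕ → ℕ) (q : Finset Atom) : Finset Atom := q.image (appA θ)

/-- `db ⊨ q`: some valuation sends every atom of `q` into `db`. -/
def Sat (db q : Finset Atom) : Prop := ∃ θ : ℕ → ℕ, appQ θ q ⊆ db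

/-- `db ∈ CERTAINTY(q)`: every repair of `db` satisfies `q`. -/
def Certainty (S : Schema) (q db : Finset Atom) : Prop :=
  ∀ r : Finset Atom, IsRepair S db r → Sat r q

/-- Variables of a query. -/
def varsQ (q : Finset Atom) : Finset ℕ := q.biUnion varsA

/-- Constants of a query. -/
def constsQ (q : Finset Atom) : Finset ℕ := q.biUnion constsA

/-- `q` has no self-join: no two distinct atoms share a relation name. -/
def NoSelfJoin (q : Finset Atom) : Prop := ∀ F ∈ q, ∀ G ∈ q, F.rel = G.rel → F = G

/-- `db` is purified relative to `q`. -/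
def Purified (q db : Finset Atom) : Prop :=
  ∀ A ∈ db, ∃ θ : ℕ → ℕ, A ∈ appQ θ q ∧ appQ θ q ⊆ db

/-- Active domain of a database: all constants occurring in its facts. -/
def adom (db : Finset Atom) : Finset ℕ := db.biUnion constsA

/-- Membership in the attribute closure of `X` under a set `FDs` of
functional dependencies (standard implication of functional dependencies). -/
inductive InCl (FDs : Set (Finset ℕ × Finset ℕ)) (X : Finset ℕ) : ℕ → Prop
  | base {x : ℕ} : x ∈ X → InCl FDs X x
  | step {Z W : Finset ℕ} {w : ℕ} : (Z, W) ∈ FDs → (∀ z ∈ Z, InCl FDs X z) →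
      w ∈ W → InCl FDs X w

/-- `FDs ⊨ X → Y`. -/
def FDImp (FDs : Set (Finset ℕ × Finset ℕ)) (X Y : Finset ℕ) : Prop :=
  ∀ y ∈ Y, InCl FDs X y

/-- `FD(q) = { key(F) → vars(F) : F ∈ q }`. -/
def FDq (S : Schema) (q : Finset Atom) : Set (Finset ℕ × Finset ℕ) :=
  {p | ∃ F ∈ q, p = (keyVars S F, varsA F)}

/-- `F^{+,q} = {x ∈ vars(q) : FD(q \ {F}) ⊨ key(F) → x}`. -/
def plusCl (S : Schema) (q : Finset Atom) (F : Atom) : Set ℕ :=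
  {x | x ∈ varsQ q ∧ InCl (FDq S (q.erase F)) (keyVars S F) x}

/-- `F^{⊕,q} = {x ∈ vars(q) : FD(q) ⊨ key(F) → x}`. -/
def oplusCl (S : Schema) (q : Finset Atom) (F : Atom) : Set ℕ :=
  {x | x ∈ varsQ q ∧ InCl (FDq S q) (keyVars S F) x}

/-- A (simple) path in an undirected graph given by edge relation `E`. -/
def IsPath (E : Atom → Atom → Prop) (p : List Atom) : Prop :=
  p ≠ [] ∧ p.Nodup ∧ List.Chain' E p

/-- `E` is (the edge relation of) a join tree for `q`: a tree (unique simple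
paths between any two vertices) on the atoms of `q` satisfying the
Connectedness Condition. -/
def IsJoinTree (q : Finset Atom) (E : Atom → Atom → Prop) : Prop :=
  (∀ a b, E a b → E b a) ∧
  (∀ a b, E a b → a ∈ q ∧ b ∈ q ∧ a ≠ b) ∧
  (∀ a ∈ q, ∀ b ∈ q, ∃! p : List Atom,
      IsPath E p ∧ p.head? = some a ∧ p.getLast? = some b) ∧
  (∀ x : ℕ, ∀ F ∈ q, ∀ G ∈ q, x ∈ varsA F → x ∈ varsA G →
      ∀ p : List Atom, IsPath E p → p.head? = some F → p.getLast? = some G →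
        ∀ H ∈ p, x ∈ varsA H)

/-- The consecutive pairs (edges) of a path. -/
def edgePairs (p : List Atom) : List (Atom × Atom) := p.zip p.tail

/-- `F ↝ G` in the attack graph of the join tree `E` of `q`: `F ≠ G` are atoms
of `q`, and no label `vars(H) ∩ vars(H')` of an edge on the (unique) path from
`F` to `G` is contained in `F^{+,q}`. -/
def Attacks (S : Schema) (q : Finset Atom) (E : Atom → Atom → Prop) (F G : Atom) : Prop :=
  F ∈ q ∧ G ∈ q ∧ F ≠ G ∧
  ∀ p : List Atom, IsPath E p → p.head? = some F → p.getLast? = some G →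
    ∀ e ∈ edgePairs p, ¬ ((↑(varsA e.1 ∩ varsA e.2) : Set ℕ) ⊆ plusCl S q F)

/-- The attack `F ↝ G` is weak: `key(G) ⊆ F^{⊕,q}`. -/
def Weak (S : Schema) (q : Finset Atom) (F G : Atom) : Prop :=
  (↑(keyVars S G) : Set ℕ) ⊆ oplusCl S q F

/-- Consecutive pairs of a cyclic sequence, including the wrap-around pair. -/
def cyclePairs (L : List Atom) : List (Atom × Atom) := L.zip (L.rotate 1)

/-- `L` is an (elementary directed) cycle in the directed graph `att`. -/
def IsCycle (att : Atom → Atom → Prop) (L : List Atom) : Prop :=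
  2 ≤ L.length ∧ L.Nodup ∧ ∀ e ∈ cyclePairs L, att e.1 e.2

/-- A cycle is terminal: no edge leads from a vertex in the cycle to a vertex
outside the cycle. -/
def TerminalCycle (att : Atom → Atom → Prop) (L : List Atom) : Prop :=
  ∀ a ∈ L, ∀ b, att a b → b ∈ L

/-- A strong cycle in the attack graph: a cycle at least one attack of which is strong. -/
def StrongCycle (S : Schema) (q : Finset Atom) (E : Atom → Atom → Prop)
    (L : List Atom) : Prop :=
  IsCycle (Attacks S q E) L ∧ ∃ e ∈ cyclePairs L, ¬ Weak S q e.1 e.2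

/-- Substituting constant `c` for variable `z` in a term. -/
def substT (z c : ℕ) : Trm → Trm
  | Sum.inl v => if v = z then Sum.inr c else Sum.inl v
  | Sum.inr d => Sum.inr d

/-- `F[z→c]`. -/
def substA (z c : ℕ) (A : Atom) : Atom := ⟨A.rel, A.args.map (substT z c)⟩

/-- `q[z→c]`. -/
def substQ (z c : ℕ) (q : Finset Atom) : Finset Atom := q.image (substA z c)

/-- Simultaneous substitution of the constants `bs` for the (distinct)
variables `xs` (componentwise) in a term. -/
def substLT (xs bs : List ℕ) : Trm → Trm
  | Sum.inl v => if v ∈ xs then Sum.inr (bs.getD (xs.idxOf v) 0) else Sum.inl v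
  | Sum.inr d => Sum.inr d

/-- `F[x⃗→b⃗]`. -/
def substLA (xs bs : List ℕ) (A : Atom) : Atom := ⟨A.rel, A.args.map (substLT xs bs)⟩

/-- `q[x⃗→b⃗]`. -/
def substLQ (xs bs : List ℕ) (q : Finset Atom) : Finset Atom := q.image (substLA xs bs)

/-- First-order formulas over the relational vocabulary (relation names and
constants coded by naturals, variables coded by naturals). -/
inductive Fml where
  | atom (R : ℕ) (args : List Trm)
  | eq (s t : Trm)
  | tru
  | not (φ : Fml)
  | and (φ ψ : Fml)
  | or (φ ψ : Fml)
  | ex (v : ℕ) (φ : Fml)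
  | all (v : ℕ) (φ : Fml)

/-- Value of a term under an assignment of constants to variables. -/
def evalT (σ : ℕ → ℕ) : Trm → ℕ
  | Sum.inl v => σ v
  | Sum.inr c => c

/-- Satisfaction of a first-order formula in the finite structure whose
relations are given by the facts of `db`, with quantifiers ranging over `dom`. -/
def Holds (db : Finset Atom) (dom : Finset ℕ) : Fml → (ℕ → ℕ) → Prop
  | .atom R args, σ => (⟨R, args.map fun t => Sum.inr (evalT σ t)⟩ : Atom) ∈ db
  | .eq s t, σ => evalT σ s = evalT σ t
  | .tru, _ => True
  | .not φ, σ => ¬ Holds db dom φ σ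
  | .and φ ψ, σ => Holds db dom φ σ ∧ Holds db dom ψ σ
  | .or φ ψ, σ => Holds db dom φ σ ∨ Holds db dom ψ σ
  | .ex v φ, σ => ∃ a ∈ dom, Holds db dom φ (Function.update σ v a)
  | .all v φ, σ => ∀ a ∈ dom, Holds db dom φ (Function.update σ v a)

/-- Free variables of a formula. -/
def Fml.free : Fml → Finset ℕ
  | .atom _ args => varsL args
  | .eq s t => varsL [s, t]
  | .tru => ∅
  | .not φ => φ.free
  | .and φ ψ => φ.free ∪ ψ.free
  | .or φ ψ => φ.free ∪ ψ.free
  | .ex v φ => φ.free.erase v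
  | .all v φ => φ.free.erase v

/-- Relation names occurring in a formula. -/
def Fml.rels : Fml → Finset ℕ
  | .atom R _ => {R}
  | .eq _ _ => ∅
  | .tru => ∅
  | .not φ => φ.rels
  | .and φ ψ => φ.rels ∪ ψ.rels
  | .or φ ψ => φ.rels ∪ ψ.rels
  | .ex _ φ => φ.rels
  | .all _ φ => φ.rels

/-- Constants occurring in a formula. -/
def Fml.consts : Fml → Finset ℕ
  | .atom _ args => constsL args
  | .eq s t => constsL [s, t]
  | .tru => ∅
  | .not φ => φ.consts
  | .and φ ψ => φ.consts ∪ ψ.consts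
  | .or φ ψ => φ.consts ∪ ψ.consts
  | .ex _ φ => φ.consts
  | .all _ φ => φ.consts

/-- Well-formed formula: every atom has as many arguments as the arity of its
relation name. -/
def FmlWf (S : Schema) : Fml → Prop
  | .atom R args => args.length = S.arity R
  | .eq _ _ => True
  | .tru => True
  | .not φ => FmlWf S φ
  | .and φ ψ => FmlWf S φ ∧ FmlWf S ψ
  | .or φ ψ => FmlWf S φ ∧ FmlWf S ψ
  | .ex _ φ => FmlWf S φ
  | .all _ φ => FmlWf S φ

/-- The safety predicate of Dalvi, Ré and Suciu (rules SE1–SE4). -/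
inductive Safe (S : Schema) : Finset Atom → Prop
  | se1 (A : Atom) : isFact A → Safe S {A}
  | se2 (q₁ q₂ : Finset Atom) : q₁.Nonempty → q₂.Nonempty →
      Disjoint (varsQ q₁) (varsQ q₂) → Safe S q₁ → Safe S q₂ → Safe S (q₁ ∪ q₂)
  | se3 (q : Finset Atom) (x a : ℕ) : (∀ F ∈ q, x ∈ keyVars S F) →
      Safe S (substQ x a q) → Safe S q
  | se4 (q : Finset Atom) (F : Atom) (x a : ℕ) : F ∈ q → keyVars S F = ∅ →
      varsA F ≠ ∅ → x ∈ varsA F → Safe S (substQ x a q) → Safe S q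

/-- The atom `R_i(x_i ; x_{i+1})` (with `x_{k+1} = x_1`) of the query `acq_k`;
variable `x_i` is coded by `i`, relation name `R_i` by `i`. -/
def Ratom (k i : ℕ) : Atom := ⟨i, [Sum.inl i, Sum.inl (i % k + 1)]⟩

/-- The all-key atom `S_k(x_1,…,x_k)` of the query `acq_k`;
relation name `S_k` is coded by `0`. -/
def Satom (k : ℕ) : Atom := ⟨0, (List.range k).map (fun j => Sum.inl (j + 1))⟩

/-- The query `acq_k = {R_1(x_1;x_2), …, R_k(x_k;x_1), S_k(x_1,…,x_k)}`. -/
def acq (k : ℕ) : Finset Atom := ((Finset.Icc 1 k).image (Ratom k)) ∪ {Satom k}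

/-- Sum of `Pr` over the possible (= consistent) worlds of `db` satisfying `P`. -/
def prOf (S : Schema) (db : Finset Atom) (Pr : Finset Atom → ℚ)
    (P : Finset Atom → Prop) : ℚ :=
  ∑ w ∈ db.powerset.filter (fun w => Consistent S w ∧ P w), Pr w

end

/-! ### Helper lemmas -/

theorem mem_varsL_iff (l : List Trm) (x : ℕ) : x ∈ varsL l ↔ Sum.inl x ∈ l := by
  unfold varsL
  simp [Sum.getLeft?_eq_some_iff]

theorem mem_constsL_iff (l : List Trm) (x : ℕ) : x ∈ constsL l ↔ Sum.inr x ∈ l := by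
  unfold constsL
  simp [Sum.getRight?_eq_some_iff]

theorem keyVars_sub (S : Schema) (A : Atom) {x : ℕ} (h : x ∈ keyVars S A) : x ∈ varsA A := by
  unfold keyVars at h
  unfold varsA
  rw [mem_varsL_iff] at *
  exact List.mem_of_mem_take h

theorem map_appT_eq (θ σ : ℕ → ℕ) (l : List Trm) (h : l.map (appT θ) = l.map (appT σ)) :
    ∀ x ∈ varsL l, θ x = σ x := by
  intro x hx
  rw [mem_varsL_iff] at hx
  have := List.map_inj_left.1 h _ hx
  simpa [appT] using this

theorem appA_congr (θ σ : ℕ → ℕ) (A : Atom) (h : ∀ x ∈ varsA A, θ x = σ x) :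
    appA θ A = appA σ A := by
  unfold appA
  congr 1
  apply List.map_congr_left
  rintro (v | c) ht
  · simp only [appT]
    rw [h v ((mem_varsL_iff _ _).2 ht)]
  · rfl

theorem appA_inj (θ σ : ℕ → ℕ) (A : Atom) (h : appA θ A = appA σ A) :
    ∀ x ∈ varsA A, θ x = σ x := by
  unfold appA at h
  injection h with h1 h2
  exact map_appT_eq θ σ _ h2

theorem keyEqual_appA (S : Schema) (θ σ : ℕ → ℕ) (A : Atom)
    (h : keyEqual S (appA θ A) (appA σ A)) : ∀ x ∈ keyVars S A, θ x = σ x := by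
  obtain ⟨_, h⟩ := h
  simp only [appA, ← List.map_take] at h
  exact map_appT_eq θ σ _ h

theorem appA_substLA (θ : ℕ → ℕ) (xs as : List ℕ) (A : Atom) :
    appA θ (substLA xs as A) =
      appA (fun v => if v ∈ xs then as.getD (xs.idxOf v) 0 else θ v) A := by
  unfold appA substLA
  congr 1
  rw [List.map_map]
  apply List.map_congr_left
  rintro (v | c) ht
  · by_cases hv : v ∈ xs <;> simp [appT, substLT, hv]
  · rfl

theorem keyEqual_symm {S : Schema} {A B : Atom} (h : keyEqual S A B) : keyEqual S B A :=
  ⟨h.1.symm, h.2.symm⟩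

theorem keyEqual_trans {S : Schema} {A B C : Atom} (h : keyEqual S A B) (h' : keyEqual S B C) :
    keyEqual S A C := ⟨h.1.trans h'.1, h.2.trans h'.2⟩

theorem keyEqual_refl (S : Schema) (A : Atom) : keyEqual S A A := ⟨rfl, rfl⟩

theorem isRepair_iff (S : Schema) (db r : Finset Atom) :
    IsRepair S db r ↔ r ⊆ db ∧ Consistent S r ∧ ∀ A ∈ db, ∃ B ∈ r, keyEqual S A B := by
  constructor
  · rintro ⟨h1, h2, h3⟩
    refine ⟨h1, h2, fun A hA => ?_⟩
    by_contra hcon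
    push Not at hcon
    have := h3 (insert A r) (Finset.subset_insert _ _) (Finset.insert_subset hA h1) ?_
    · exact hcon A (this ▸ Finset.mem_insert_self A r) (keyEqual_refl S A)
    · intro B hB C hC hBC
      rcases Finset.mem_insert.1 hB with rfl | hB' <;> rcases Finset.mem_insert.1 hC with rfl | hC'
      · rfl
      · exact absurd hBC (hcon C hC')
      · exact absurd (keyEqual_symm hBC) (hcon B hB')
      · exact h2 B hB' C hC' hBC
  · rintro ⟨h1, h2, h3⟩
    refine ⟨h1, h2, fun r' hr hr' hc => ?_⟩
    apply Finset.Subset.antisymm _ hr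
    intro A hA
    obtain ⟨B, hB, hAB⟩ := h3 A (hr' hA)
    rw [hc A hA B (hr hB) hAB]
    exact hB

theorem exists_repair (S : Schema) (db : Finset Atom) : ∃ r, IsRepair S db r := by
  have hne : Nonempty Atom := ⟨⟨0, []⟩⟩
  let f : Atom → Atom := fun A => Classical.epsilon (fun B => B ∈ db ∧ keyEqual S A B)
  have hf : ∀ A ∈ db, f A ∈ db ∧ keyEqual S A (f A) := fun A hA =>
    Classical.epsilon_spec (p := fun B => B ∈ db ∧ keyEqual S A B) ⟨A, hA, keyEqual_refl S A⟩
  have hf2 : ∀ A B, keyEqual S A B → f A = f B := by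
    intro A B hAB
    have : (fun C => C ∈ db ∧ keyEqual S A C) = (fun C => C ∈ db ∧ keyEqual S B C) := by
      funext C
      exact propext ⟨fun h => ⟨h.1, keyEqual_trans (keyEqual_symm hAB) h.2⟩,
        fun h => ⟨h.1, keyEqual_trans hAB h.2⟩⟩
    simp only [f, this]
  refine ⟨db.image f, (isRepair_iff S db _).2 ⟨?_, ?_, ?_⟩⟩
  · intro B hB
    obtain ⟨A, hA, rfl⟩ := Finset.mem_image.1 hB
    exact (hf A hA).1
  · intro A hA B hB hAB
    obtain ⟨A', hA', rfl⟩ := Finset.mem_image.1 hA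
    obtain ⟨B', hB', rfl⟩ := Finset.mem_image.1 hB
    exact hf2 _ _ (keyEqual_trans (hf A' hA').2
      (keyEqual_trans hAB (keyEqual_symm (hf B' hB').2)))
  · intro A hA
    exact ⟨f A, Finset.mem_image_of_mem f hA, (hf A hA).2⟩

theorem eq_map_of_getD (xs as : List ℕ) (hnd : xs.Nodup) (hlen : as.length = xs.length)
    (σ : ℕ → ℕ) (h : ∀ v ∈ xs, σ v = as.getD (xs.idxOf v) 0) : as = xs.map σ := by
  apply List.ext_getElem
  · simpa using hlen
  · intro n h1 h2
    have hn : n < xs.length := hlen ▸ h1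
    rw [List.getElem_map, h _ (List.getElem_mem hn), hnd.idxOf_getElem n hn]
    simp [List.getD_eq_getElem?_getD, h1]

theorem getD_map_idxOf (xs : List ℕ) (σ : ℕ → ℕ) (v : ℕ) (hv : v ∈ xs) :
    (xs.map σ).getD (xs.idxOf v) 0 = σ v := by
  have h1 : xs.idxOf v < xs.length := List.idxOf_lt_length_iff.2 hv
  simp [List.getD_eq_getElem?_getD, h1]

theorem mem_adom_of (db : Finset Atom) (θ : ℕ → ℕ) (A : Atom) (h : appA θ A ∈ db) (v : ℕ)
    (hv : v ∈ varsA A) : θ v ∈ adom db := by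
  refine Finset.mem_biUnion.2 ⟨_, h, ?_⟩
  unfold constsA
  rw [mem_constsL_iff]
  exact List.mem_map.2 ⟨Sum.inl v, (mem_varsL_iff _ _).1 hv, rfl⟩

/-- The core combinatorial argument, once the shared variables are known to be key variables. -/
theorem core_iff (S : Schema) (ℓ : ℕ)
    (q : Finset Atom) (hnsj : NoSelfJoin q)
    (Q : Fin ℓ → Finset Atom) (hQ : ∀ H, H ∈ q ↔ ∃ i, H ∈ Q i)
    (hQne : ∀ i, ∃ H, H ∈ Q i)
    (hQu : ∀ i j H, H ∈ Q i → H ∈ Q j → i = j)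
    (db : Finset Atom) (hpur : Purified q db)
    (xs : Fin ℓ → List ℕ)
    (hxsnd : ∀ i : Fin ℓ, (xs i).Nodup)
    (hshare : ∀ i j x, i ≠ j → x ∈ varsQ (Q i) → x ∈ varsQ (Q j) → x ∈ xs i)
    (hkey : ∀ i, ∀ H ∈ Q i, ∀ x ∈ xs i, x ∈ keyVars S H)
    (part : Fin ℓ → List ℕ → Finset Atom)
    (hpart : ∀ (i : Fin ℓ) (as : List ℕ) (A : Atom), A ∈ part i as ↔
      (A ∈ db ∧ ∃ θ : ℕ → ℕ, ∃ H ∈ Q i,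
        (∀ v ∈ xs i, θ v = as.getD ((xs i).idxOf v) 0) ∧ A = appA θ H))
    (clean : Fin ℓ → Finset Atom)
    (hclean : ∀ (i : Fin ℓ) (A : Atom), A ∈ clean i ↔
      ∃ as : List ℕ, as.length = (xs i).length ∧ (∀ a ∈ as, a ∈ adom db) ∧
        A ∈ part i as ∧ Certainty S (Q i) (part i as)) :
    Certainty S q db ↔ Sat (Finset.univ.biUnion clean) q := by
  have hQq : ∀ i, ∀ H ∈ Q i, H ∈ q := fun i H h => (hQ H).2 ⟨i, h⟩
  have hkv : ∀ i, ∀ H ∈ Q i, ∀ x ∈ xs i, x ∈ varsA H :=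
    fun i H hH x hx => keyVars_sub S H (hkey i H hH x hx)
  have L0 : ∀ B ∈ db, ∃ θ, ∃ H ∈ q, B = appA θ H := by
    intro B hB
    obtain ⟨θ, h1, _⟩ := hpur B hB
    obtain ⟨H, hH, rfl⟩ := Finset.mem_image.1 h1
    exact ⟨θ, H, hH, rfl⟩
  have L1 : ∀ i as σ H, H ∈ q → appA σ H ∈ part i as →
      H ∈ Q i ∧ ∀ v ∈ xs i, σ v = as.getD ((xs i).idxOf v) 0 := by
    intro i as σ H hH h
    obtain ⟨_, θ, H', hH', hv, heq⟩ := (hpart i as _).1 h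
    have hrel : (appA σ H).rel = (appA θ H').rel := by rw [heq]
    have : H = H' := hnsj H hH H' (hQq i H' hH') hrel
    subst this
    refine ⟨hH', fun v hv' => ?_⟩
    rw [appA_inj σ θ H heq v (hkv i H hH' v hv')]
    exact hv v hv'
  have L2 : ∀ i σ H, H ∈ Q i → appA σ H ∈ db → appA σ H ∈ part i ((xs i).map σ) := by
    intro i σ H hH h
    exact (hpart i _ _).2 ⟨h, σ, H, hH, fun v hv => (getD_map_idxOf _ σ v hv).symm, rfl⟩
  have Lsat : ∀ i as A B, A ∈ part i as → B ∈ db → keyEqual S A B → B ∈ part i as := by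
    intro i as A B hA hB hAB
    obtain ⟨_, θ, H, hH, hv, rfl⟩ := (hpart i as _).1 hA
    obtain ⟨σ, H', hH', rfl⟩ := L0 B hB
    have : H = H' := hnsj H (hQq i H hH) H' hH' hAB.1
    subst this
    refine (hpart i as _).2 ⟨hB, σ, H, hH, fun v hv' => ?_, rfl⟩
    rw [← keyEqual_appA S θ σ H hAB v (hkey i H hH v hv')]
    exact hv v hv'
  have Lsub : ∀ i as, part i as ⊆ db := fun i as A hA => ((hpart i as A).1 hA).1
  constructor
  · intro hcert
    have hrep : ∀ i as, ∃ r, IsRepair S (part i as) r ∧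
        (Sat r (Q i) → Certainty S (Q i) (part i as)) := by
      intro i as
      by_cases hc : Certainty S (Q i) (part i as)
      · obtain ⟨r, hr⟩ := exists_repair S (part i as)
        exact ⟨r, hr, fun _ => hc⟩
      · have hc' := hc
        unfold Certainty at hc'
        push Not at hc'
        obtain ⟨r, hr, hns⟩ := hc'
        exact ⟨r, hr, fun h => absurd h hns⟩
    choose rep hrep1 hrep2 using hrep
    have hrep1' := fun i as => (isRepair_iff S _ _).1 (hrep1 i as)
    let r : Finset Atom := db.filter
      (fun A => ∃ i as, as.length = (xs i).length ∧ A ∈ rep i as)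
    have hmemr : ∀ A, A ∈ r ↔ A ∈ db ∧ ∃ i as, as.length = (xs i).length ∧ A ∈ rep i as := by
      intro A
      simp [r]
    -- uniqueness of the partition of a fact
    have huniq : ∀ A i as j bs, as.length = (xs i).length → bs.length = (xs j).length →
        A ∈ part i as → A ∈ part j bs → i = j ∧ as = bs := by
      intro A i as j bs hl1 hl2 h1 h2
      obtain ⟨_, θ, H, hH, hv, rfl⟩ := (hpart i as _).1 h1
      obtain ⟨hH2, hv2⟩ := L1 j bs θ H (hQq i H hH) h2
      have hij := hQu i j H hH hH2
      subst hij
      refine ⟨rfl, ?_⟩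
      rw [eq_map_of_getD (xs i) as (hxsnd i) hl1 θ hv, eq_map_of_getD (xs i) bs (hxsnd i) hl2 θ hv2]
    have hr : IsRepair S db r := by
      rw [isRepair_iff]
      refine ⟨Finset.filter_subset _ _, ?_, ?_⟩
      · intro A hA B hB hAB
        obtain ⟨_, i, as, hl, hA⟩ := (hmemr A).1 hA
        obtain ⟨hBdb, j, bs, hl', hB⟩ := (hmemr B).1 hB
        have hB1 := Lsat i as A B ((hrep1' i as).1 hA) hBdb hAB
        obtain ⟨rfl, rfl⟩ := huniq B i as j bs hl hl' hB1 ((hrep1' j bs).1 hB)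
        exact (hrep1' i as).2.1 A hA B hB hAB
      · intro A hA
        obtain ⟨θ, H, hH, rfl⟩ := L0 A hA
        obtain ⟨i, hi⟩ := (hQ H).1 hH
        obtain ⟨B, hB, hAB⟩ := (hrep1' i _).2.2 _ (L2 i θ H hi hA)
        exact ⟨B, (hmemr B).2 ⟨Lsub _ _ ((hrep1' i _).1 hB), i, _, by simp, hB⟩, hAB⟩
    obtain ⟨θ, hθ⟩ := hcert r hr
    refine ⟨θ, ?_⟩
    have hin : ∀ i, ∀ H ∈ Q i, appA θ H ∈ rep i ((xs i).map θ) := by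
      intro i H hH
      obtain ⟨hdb', j, bs, hl, hm⟩ :=
        (hmemr _).1 (hθ (Finset.mem_image_of_mem (appA θ) (hQq i H hH)))
      obtain ⟨rfl, rfl⟩ := huniq _ i _ j bs (by simp) hl (L2 i θ H hH hdb') ((hrep1' j bs).1 hm)
      exact hm
    intro A hA
    obtain ⟨H, hH, rfl⟩ := Finset.mem_image.1 hA
    obtain ⟨i, hi⟩ := (hQ H).1 hH
    refine Finset.mem_biUnion.2 ⟨i, Finset.mem_univ i, (hclean i _).2
      ⟨(xs i).map θ, by simp, ?_, (hrep1' i _).1 (hin i H hi), hrep2 i _ ⟨θ, ?_⟩⟩⟩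
    · intro a ha
      obtain ⟨v, hv, rfl⟩ := List.mem_map.1 ha
      exact mem_adom_of db θ H (Lsub _ _ ((hrep1' i _).1 (hin i H hi))) v (hkv i H hi v hv)
    · intro B hB
      obtain ⟨H', hH', rfl⟩ := Finset.mem_image.1 hB
      exact hin i H' hH'
  · rintro ⟨θ, hθ⟩ r hr
    have hr' := (isRepair_iff S _ _).1 hr
    have hc : ∀ i, Certainty S (Q i) (part i ((xs i).map θ)) := by
      intro i
      obtain ⟨H, hH⟩ := hQne i
      obtain ⟨j, _, hj⟩ := Finset.mem_biUnion.1
        (hθ (Finset.mem_image_of_mem (appA θ) (hQq i H hH)))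
      obtain ⟨as, hl, _, hp, hcert⟩ := (hclean j _).1 hj
      obtain ⟨hH2, hv⟩ := L1 j as θ H (hQq i H hH) hp
      have hij := hQu i j H hH hH2
      subst hij
      rw [← eq_map_of_getD (xs i) as (hxsnd i) hl θ hv]
      exact hcert
    have hsat : ∀ i, ∃ σ : ℕ → ℕ, (∀ H ∈ Q i, appA σ H ∈ r) ∧ ∀ v ∈ xs i, σ v = θ v := by
      intro i
      have hrr : IsRepair S (part i ((xs i).map θ)) (r.filter (· ∈ part i ((xs i).map θ))) := by
        rw [isRepair_iff]
        refine ⟨fun A hA => (Finset.mem_filter.1 hA).2, ?_, ?_⟩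
        · intro A hA B hB hAB
          exact hr'.2.1 A (Finset.mem_filter.1 hA).1 B (Finset.mem_filter.1 hB).1 hAB
        · intro A hA
          obtain ⟨B, hB, hAB⟩ := hr'.2.2 A (Lsub _ _ hA)
          exact ⟨B, Finset.mem_filter.2 ⟨hB, Lsat _ _ A B hA (hr'.1 hB) hAB⟩, hAB⟩
      obtain ⟨σ, hσ⟩ := hc i _ hrr
      have hσ' : ∀ H ∈ Q i, appA σ H ∈ r ∧ appA σ H ∈ part i ((xs i).map θ) := fun H hH =>
        Finset.mem_filter.1 (hσ (Finset.mem_image_of_mem (appA σ) hH))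
      refine ⟨σ, fun H hH => (hσ' H hH).1, fun v hv => ?_⟩
      obtain ⟨H, hH⟩ := hQne i
      rw [(L1 i _ σ H (hQq i H hH) (hσ' H hH).2).2 v hv, getD_map_idxOf _ θ v hv]
    choose σ hσ1 hσ2 using hsat
    let τ : ℕ → ℕ := fun v =>
      if h : ∃ i, v ∈ varsQ (Q i) then σ h.choose v else θ v
    have hτ : ∀ i, ∀ v ∈ varsQ (Q i), τ v = σ i v := by
      intro i v hv
      have h : ∃ i, v ∈ varsQ (Q i) := ⟨i, hv⟩
      have hs := h.choose_spec
      simp only [τ, dif_pos h]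
      by_cases hij : i = h.choose
      · rw [← hij]
      · rw [hσ2 i v (hshare i _ v hij hv hs),
          hσ2 _ v (hshare _ i v (Ne.symm hij) hs hv)]
    refine ⟨τ, ?_⟩
    intro A hA
    obtain ⟨H, hH, rfl⟩ := Finset.mem_image.1 hA
    obtain ⟨i, hi⟩ := (hQ H).1 hH
    rw [appA_congr τ (σ i) H (fun x hx => hτ i x (Finset.mem_biUnion.2 ⟨H, hi, hx⟩))]
    exact hσ1 i H hi

/-! ### Paths in the join tree -/

theorem edgePairs_cons_cons (a b : Atom) (t : List Atom) :
    edgePairs (a :: b :: t) = (a, b) :: edgePairs (b :: t) := rfl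

theorem edgePairs_suffix (s l : List Atom) : ∀ e ∈ edgePairs l, e ∈ edgePairs (s ++ l) := by
  induction s with
  | nil => intro e he; exact he
  | cons a s ih =>
    intro e he
    have h := ih e he
    show e ∈ edgePairs (a :: (s ++ l))
    cases hsl : s ++ l with
    | nil => rw [hsl] at h; simp [edgePairs] at h
    | cons b t =>
      rw [edgePairs_cons_cons]
      rw [hsl] at h
      exact List.mem_cons_of_mem _ h

theorem exists_path_concat (E : Atom → Atom → Prop) (g h : Atom) (p2 : List Atom)
    (hp2 : IsPath E p2) (hh2 : p2.head? = some g) (hl2 : p2.getLast? = some h) :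
    ∀ (p1 : List Atom) (f : Atom), List.IsChain E p1 → p1.head? = some f → p1.getLast? = some g →
      ∃ p, IsPath E p ∧ p.head? = some f ∧ p.getLast? = some h ∧
        ∀ e ∈ edgePairs p, e ∈ edgePairs p1 ∨ e ∈ edgePairs p2 := by
  intro p1
  induction p1 with
  | nil => intro f _ hf; simp at hf
  | cons a t ih =>
    intro f hch hf hl
    simp only [List.head?_cons, Option.some.injEq] at hf
    subst hf
    cases t with
    | nil =>
      simp at hl
      subst hl
      exact ⟨p2, hp2, hh2, hl2, fun e he => Or.inr he⟩
    | cons b t =>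
      rw [List.isChain_cons_cons] at hch
      obtain ⟨p, hp, hph, hpl, hpe⟩ := ih b hch.2 rfl (by simpa [List.getLast?_cons_cons] using hl)
      obtain ⟨hne, hnd, hc⟩ := hp
      by_cases ha : a ∈ p
      · obtain ⟨s, u, rfl⟩ := List.append_of_mem ha
        refine ⟨a :: u, ⟨by simp, (List.nodup_append.1 hnd).2.1, ?_⟩, rfl, ?_, ?_⟩
        · exact List.IsChain.right_of_append hc
        · rw [← hpl, List.getLast?_append, List.getLast?_cons]; rfl
        · intro e he
          rcases hpe e (edgePairs_suffix s _ e he) with h | h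
          · left; rw [edgePairs_cons_cons]; exact List.mem_cons_of_mem _ h
          · exact Or.inr h
      · cases p with
        | nil => exact absurd rfl hne
        | cons c u =>
          simp only [List.head?_cons, Option.some.injEq] at hph
          subst hph
          refine ⟨a :: c :: u, ⟨by simp, List.nodup_cons.2 ⟨ha, hnd⟩,
            List.isChain_cons_cons.2 ⟨hch.1, hc⟩⟩, rfl, ?_, ?_⟩
          · rw [List.getLast?_cons_cons]; exact hpl
          · intro e he
            rw [edgePairs_cons_cons] at he ⊢
            rcases List.mem_cons.1 he with h | h
            · left; rw [h]; exact List.mem_cons_self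
            · rcases hpe e h with h | h
              · left; exact List.mem_cons_of_mem _ h
              · exact Or.inr h

theorem exists_last_edge (b : Atom) : ∀ (p : List Atom) (a : Atom), p.head? = some a →
    p.getLast? = some b → a ≠ b → ∃ e ∈ edgePairs p, e.2 = b := by
  intro p
  induction p with
  | nil => intro a h; simp at h
  | cons c t ih =>
    intro a ha hl hab
    simp only [List.head?_cons, Option.some.injEq] at ha
    subst ha
    cases t with
    | nil => simp at hl; exact absurd hl hab
    | cons d u =>
      rw [edgePairs_cons_cons]
      by_cases hd : d = b
      · exact ⟨(c, d), List.mem_cons_self, hd⟩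
      · obtain ⟨e, he, h⟩ := ih d rfl (by simpa [List.getLast?_cons_cons] using hl) hd
        exact ⟨e, List.mem_cons_of_mem _ he, h⟩

theorem edge_mem (p : List Atom) (e : Atom × Atom) (he : e ∈ edgePairs p) :
    e.1 ∈ p ∧ e.2 ∈ p := by
  obtain ⟨a, b⟩ := e
  have := List.of_mem_zip he
  exact ⟨this.1, List.mem_of_mem_tail this.2⟩

theorem mem_plus_of_shared (S : Schema) (q : Finset Atom) (E : Atom → Atom → Prop)
    (hjt : IsJoinTree q E) (A B H : Atom) (hAB : Attacks S q E A B) (hH : H ∈ q)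
    (hAH : A ≠ H) (hnot : ¬ Attacks S q E A H) (x : ℕ) (hx : x ∈ varsA A ∨ x ∈ varsA B)
    (hxH : x ∈ varsA H) : x ∈ plusCl S q A := by
  obtain ⟨_, _, hun, hconn⟩ := hjt
  obtain ⟨hA, hB, hne, hatt⟩ := hAB
  have : ∃ p, IsPath E p ∧ p.head? = some A ∧ p.getLast? = some H ∧
      ∃ e ∈ edgePairs p, (↑(varsA e.1 ∩ varsA e.2) : Set ℕ) ⊆ plusCl S q A := by
    by_contra hcon
    push Not at hcon
    exact hnot ⟨hA, hH, hAH, fun p h1 h2 h3 e he => hcon p h1 h2 h3 e he⟩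
  obtain ⟨p, hp, hph, hpl, e, he, hsub⟩ := this
  have key : ∀ (C : Atom) (p' : List Atom), C ∈ q → x ∈ varsA C → IsPath E p' →
      p'.head? = some C → p'.getLast? = some H → e ∈ edgePairs p' → x ∈ plusCl S q A := by
    intro C p' hC hxC h1 h2 h3 he'
    have hm := edge_mem p' e he'
    apply hsub
    simp only [Finset.coe_inter, Set.mem_inter_iff, Finset.mem_coe]
    exact ⟨hconn x C hC H hH hxC hxH p' h1 h2 h3 _ hm.1,
      hconn x C hC H hH hxC hxH p' h1 h2 h3 _ hm.2⟩
  rcases hx with hx | hx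
  · exact key A p hA hx hp hph hpl he
  · obtain ⟨p1, ⟨h11, h12, h13⟩, _⟩ := hun A hA B hB
    obtain ⟨p2, ⟨h21, h22, h23⟩, _⟩ := hun B hB H hH
    obtain ⟨p3, h31, h32, h33, h34⟩ := exists_path_concat E B H p2 h21 h22 h23 p1 A h11.2.2 h12 h13
    have hp3 : p = p3 := (hun A hA H hH).unique ⟨hp, hph, hpl⟩ ⟨h31, h32, h33⟩
    subst hp3
    rcases h34 e he with h | h
    · exact absurd hsub (hatt p1 h11 h12 h13 e h)
    · exact key B p2 hB hx h21 h22 h23 h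

theorem exists_key_not_plus (S : Schema) (q : Finset Atom) (E : Atom → Atom → Prop)
    (hjt : IsJoinTree q E) (A B : Atom) (hAB : Attacks S q E A B) :
    ∃ z ∈ keyVars S B, z ∉ plusCl S q A := by
  by_contra hcon
  push Not at hcon
  obtain ⟨_, _, hun, _⟩ := hjt
  obtain ⟨hA, hB, hne, hatt⟩ := hAB
  obtain ⟨p, ⟨h1, h2, h3⟩, _⟩ := hun A hA B hB
  obtain ⟨e, he, heB⟩ := exists_last_edge B p A h2 h3 hne
  apply hatt p h1 h2 h3 e he
  intro y hy
  simp only [Finset.coe_inter, Set.mem_inter_iff, Finset.mem_coe, heB] at hy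
  refine ⟨Finset.mem_biUnion.2 ⟨B, hB, hy.2⟩, ?_⟩
  exact InCl.step (Z := keyVars S B) (W := varsA B)
    ⟨B, Finset.mem_erase.2 ⟨hne.symm, hB⟩, rfl⟩ (fun z hz => (hcon z hz).2) hy.2

/-- Suppose the attack graph of a join tree for the nonempty
self-join-free acyclic query `q` consists exactly of `ℓ ≥ 1` vertex-disjoint
weak cycles of length 2, `F_i ↝ G_i ↝ F_i`.  With `q_i = {F_i, G_i}`, `x⃗_i`
the sequence of distinct variables of `q_i` shared with some other `q_j`,
`db_i` the facts of `db` over the relation names of `F_i, G_i`, `part i a⃗`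
the partition of `db_i` with vector `a⃗`, and `clean i` the union of all
partitions belonging to `CERTAINTY(q_i)`:
`db ∈ CERTAINTY(q)` iff `clean(db_1) ∪ … ∪ clean(db_ℓ) ⊨ q`. -/
theorem statement12 (S : Schema) (ℓ : ℕ) (hℓ : 1 ≤ ℓ)
    (q : Finset Atom) (hq : ∀ F ∈ q, wfAtom S F) (hnsj : NoSelfJoin q)
    (E : Atom → Atom → Prop) (hjt : IsJoinTree q E)
    (F G : Fin ℓ → Atom)
    (hFG : ∀ i j : Fin ℓ, F i ≠ G j)
    (hFinj : Function.Injective F) (hGinj : Function.Injective G)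
    (hqeq : q = (Finset.univ.image F) ∪ (Finset.univ.image G))
    (hattFG : ∀ i : Fin ℓ, Attacks S q E (F i) (G i))
    (hattGF : ∀ i : Fin ℓ, Attacks S q E (G i) (F i))
    (hweakFG : ∀ i : Fin ℓ, Weak S q (F i) (G i))
    (hweakGF : ∀ i : Fin ℓ, Weak S q (G i) (F i))
    (honly : ∀ a b : Atom, Attacks S q E a b →
      ∃ i : Fin ℓ, (a = F i ∧ b = G i) ∨ (a = G i ∧ b = F i))
    (db : Finset Atom) (hdb : IsDb S db) (hpur : Purified q db)
    (xs : Fin ℓ → List ℕ)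
    (hxsnd : ∀ i : Fin ℓ, (xs i).Nodup)
    (hxs : ∀ (i : Fin ℓ) (x : ℕ), x ∈ (xs i).toFinset ↔
      (x ∈ varsQ {F i, G i} ∧ ∃ j : Fin ℓ, j ≠ i ∧ x ∈ varsQ {F j, G j}))
    (part : Fin ℓ → List ℕ → Finset Atom)
    (hpart : ∀ (i : Fin ℓ) (as : List ℕ) (A : Atom), A ∈ part i as ↔
      (A ∈ db ∧ (A.rel = (F i).rel ∨ A.rel = (G i).rel) ∧
        ∃ θ : ℕ → ℕ, A = appA θ (substLA (xs i) as (F i)) ∨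
          A = appA θ (substLA (xs i) as (G i))))
    (clean : Fin ℓ → Finset Atom)
    (hclean : ∀ (i : Fin ℓ) (A : Atom), A ∈ clean i ↔
      ∃ as : List ℕ, as.length = (xs i).length ∧ (∀ a ∈ as, a ∈ adom db) ∧
        A ∈ part i as ∧ Certainty S {F i, G i} (part i as)) :
    Certainty S q db ↔ Sat (Finset.univ.biUnion clean) q := by
  have hQ2 : ∀ (i : Fin ℓ) H, H ∈ ({F i, G i} : Finset Atom) ↔ H = F i ∨ H = G i := by
    intro i H
    simp
  have hQ : ∀ H, H ∈ q ↔ ∃ i, H ∈ ({F i, G i} : Finset Atom) := by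
    intro H
    rw [hqeq]
    simp only [Finset.mem_union, Finset.mem_image, Finset.mem_univ, true_and, hQ2]
    constructor
    · rintro (⟨i, rfl⟩ | ⟨i, rfl⟩)
      · exact ⟨i, Or.inl rfl⟩
      · exact ⟨i, Or.inr rfl⟩
    · rintro ⟨i, rfl | rfl⟩
      · exact Or.inl ⟨i, rfl⟩
      · exact Or.inr ⟨i, rfl⟩
  have hQu : ∀ i j H, H ∈ ({F i, G i} : Finset Atom) → H ∈ ({F j, G j} : Finset Atom) → i = j := by
    intro i j H h1 h2
    rw [hQ2] at h1 h2
    rcases h1 with rfl | rfl <;> rcases h2 with h2 | h2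
    · exact hFinj h2
    · exact absurd h2 (hFG i j)
    · exact absurd h2.symm (hFG j i)
    · exact hGinj h2
  have hxs' : ∀ (i : Fin ℓ) (x : ℕ), x ∈ xs i ↔
      (x ∈ varsQ {F i, G i} ∧ ∃ j : Fin ℓ, j ≠ i ∧ x ∈ varsQ {F j, G j}) := by
    intro i x
    rw [← hxs, List.mem_toFinset]
  -- attacks inside a pair
  have hatt : ∀ i, ∀ A ∈ ({F i, G i} : Finset Atom), ∃ B ∈ ({F i, G i} : Finset Atom),
      Attacks S q E A B ∧ Attacks S q E B A ∧ ∀ H ∈ ({F i, G i} : Finset Atom), H = A ∨ H = B := by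
    intro i A hA
    rw [hQ2] at hA
    rcases hA with rfl | rfl
    · exact ⟨G i, (hQ2 _ _).2 (Or.inr rfl), hattFG i, hattGF i, fun H hH => (hQ2 _ _).1 hH⟩
    · exact ⟨F i, (hQ2 _ _).2 (Or.inl rfl), hattGF i, hattFG i, fun H hH => ((hQ2 _ _).1 hH).symm⟩
  have hpair : ∀ i, ∀ A ∈ ({F i, G i} : Finset Atom), ∀ H, Attacks S q E A H →
      H ∈ ({F i, G i} : Finset Atom) := by
    intro i A hA H h
    obtain ⟨j, hj⟩ := honly A H h
    have hAj : A ∈ ({F j, G j} : Finset Atom) ∧ H ∈ ({F j, G j} : Finset Atom) := by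
      rw [hQ2, hQ2]
      tauto
    have := hQu i j A hA hAj.1
    subst this
    exact hAj.2
  have hplus : ∀ i, ∀ A ∈ ({F i, G i} : Finset Atom), ∀ x ∈ xs i, x ∈ plusCl S q A := by
    intro i A hA x hx
    obtain ⟨hx1, j, hji, hx2⟩ := (hxs' i x).1 hx
    obtain ⟨B, hB, hAB, _, hall⟩ := hatt i A hA
    obtain ⟨H, hH, hxH⟩ := Finset.mem_biUnion.1 hx2
    obtain ⟨C, hC, hxC⟩ := Finset.mem_biUnion.1 hx1
    refine mem_plus_of_shared S q E hjt A B H hAB ((hQ H).2 ⟨j, hH⟩) ?_ ?_ x ?_ hxH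
    · rintro rfl
      exact hji (hQu j i A hH hA)
    · intro h
      exact hji (hQu j i H hH (hpair i A hA H h))
    · rcases hall C hC with rfl | rfl
      · exact Or.inl hxC
      · exact Or.inr hxC
  have hpriv : ∀ i, ∀ A ∈ ({F i, G i} : Finset Atom), ∃ z ∈ keyVars S A, z ∉ xs i := by
    intro i A hA
    obtain ⟨B, hB, hAB, hBA, hall⟩ := hatt i A hA
    obtain ⟨z, hz, hzn⟩ := exists_key_not_plus S q E hjt B A hBA
    exact ⟨z, hz, fun h => hzn (hplus i B hB z h)⟩
  have hcl : ∀ i, ∀ A ∈ ({F i, G i} : Finset Atom), ∀ x,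
      InCl (FDq S (q.erase A)) (keyVars S A) x → x ∈ keyVars S A := by
    intro i A hA x hx
    induction hx with
    | base h => exact h
    | @step Z W w hmem hZ hw ih =>
      exfalso
      obtain ⟨H, hH, heq⟩ := hmem
      obtain ⟨rfl, rfl⟩ := Prod.mk.inj heq
      obtain ⟨hHA, hHq⟩ := Finset.mem_erase.1 hH
      obtain ⟨j, hj⟩ := (hQ H).1 hHq
      by_cases hji : i = j
      · subst hji
        obtain ⟨B, hB, hAB, _, hall⟩ := hatt i A hA
        rcases hall H hj with h | rfl
        · exact hHA h
        · obtain ⟨z, hz, hzn⟩ := exists_key_not_plus S q E hjt A H hAB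
          exact hzn ⟨Finset.mem_biUnion.2 ⟨H, hHq, keyVars_sub S H hz⟩, hZ z hz⟩
      · obtain ⟨z, hz, hzn⟩ := hpriv j H hj
        exact hzn ((hxs' j z).2 ⟨Finset.mem_biUnion.2 ⟨H, hj, keyVars_sub S H hz⟩, i, hji,
          Finset.mem_biUnion.2 ⟨A, hA, keyVars_sub S A (ih z hz)⟩⟩)
  refine core_iff S ℓ q hnsj (fun i => {F i, G i}) hQ (fun i => ⟨F i, (hQ2 _ _).2 (Or.inl rfl)⟩)
    hQu db hpur xs hxsnd ?_ ?_ part ?_ clean hclean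
  · intro i j x hij h1 h2
    exact (hxs' i x).2 ⟨h1, j, hij.symm, h2⟩
  · intro i H hH x hx
    exact hcl i H hH x (hplus i H hH x hx).2
  · intro i as A
    rw [hpart]
    constructor
    · rintro ⟨h1, _, θ, h3⟩
      refine ⟨h1, fun v => if v ∈ xs i then as.getD ((xs i).idxOf v) 0 else θ v, ?_⟩
      rw [appA_substLA, appA_substLA] at h3
      rcases h3 with h3 | h3
      · exact ⟨F i, (hQ2 _ _).2 (Or.inl rfl), fun v hv => if_pos hv, h3⟩
      · exact ⟨G i, (hQ2 _ _).2 (Or.inr rfl), fun v hv => if_pos hv, h3⟩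
    · rintro ⟨h1, θ, H, hH, hv, rfl⟩
      have hθ : (fun v => if v ∈ xs i then as.getD ((xs i).idxOf v) 0 else θ v) = θ := by
        funext v
        by_cases h : v ∈ xs i
        · rw [if_pos h, hv v h]
        · rw [if_neg h]
      refine ⟨h1, ?_, θ, ?_⟩
      · rcases (hQ2 _ _).1 hH with rfl | rfl
        · exact Or.inl rfl
        · exact Or.inr rfl
      · rw [appA_substLA, appA_substLA, hθ]
        rcases (hQ2 _ _).1 hH with rfl | rfl
        · exact Or.inl rfl
        · exact Or.inr rfl
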